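/- Let T ∈ (0,∞), δ ∈ (−∞, 1/4), i ∈ {1,2}, and for n ≥ 1 set λ_n = π² n² and σ_n² = λ_n^{2δ−1} · (1/2) · ( T + sin(2 λ_n^{1/2} T)/((−1)^i · 2 λ_n^{1/2}) ). For N ∈ ℕ, N ≥ 1, let γ^N = ⨂_{n≥1} N(0, 𝟙_{{1,…,N}}(n)·σ_n²) and γ = ⨂_{n≥1} N(0, σ_n²) be countable product probability measures on ℝ^ℕ. Then for every N ≥ 1 it holds that ∫ exp(−∑_{n≥1} x_n²) dγ^N(x) − ∫ exp(−∑_{n≥1} x_n²) dγ(x) ≥ ( 1 + inf_{x ∈ [2πT,∞)} sin(x)/((−1)^i x) ) · T (4π²)^{2δ−1} N^{4δ−1} / ( (1−4δ) · exp( 12(2δ−1) T π^{4δ−2} / (4δ−1) ) ) > 0. -/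

import Mathlib

open MeasureTheory ProbabilityTheory
open scoped NNReal Real

section GaussianProduct

lemma integral_exp_neg_sq_gaussianReal (v : ℝ≥0) :
    ∫ x, Real.exp (-x ^ 2) ∂(gaussianReal 0 v) = (√(1 + 2 * (v : ℝ)))⁻¹ := by
  by_cases hv : v = 0
  · simp [hv, gaussianReal_zero_var]
  have hv' : (0 : ℝ) < v := by positivity
  rw [integral_gaussianReal_eq_integral_smul hv]
  have h (x : ℝ) : gaussianPDFReal 0 v x • Real.exp (-x ^ 2) =
      (√(2 * π * v))⁻¹ * Real.exp (-((1 + 2 * v) / (2 * v) : ℝ) * x ^ 2) := by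
    rw [gaussianPDFReal, smul_eq_mul, mul_assoc, ← Real.exp_add]
    congr 2
    field_simp
    ring
  simp_rw [h]
  rw [integral_const_mul, integral_gaussian, ← Real.sqrt_inv, ← Real.sqrt_inv, ← Real.sqrt_mul
    (by positivity)]
  congr 1
  field_simp

variable {ι : Type*}

lemma integral_exp_neg_sum_sq_of_isProjectiveLimit {v : ι → ℝ≥0} {γ : Measure (ι → ℝ)}
    (hγ : IsProjectiveLimit γ fun J : Finset ι => Measure.pi fun j : J => gaussianReal 0 (v j))
    (s : Finset ι) :
    ∫ x, Real.exp (-∑ n ∈ s, (x n) ^ 2) ∂γ = ∏ n ∈ s, (√(1 + 2 * (v n : ℝ)))⁻¹ := by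
  have h1 : ∫ x, Real.exp (-∑ n ∈ s, (x n) ^ 2) ∂γ =
      ∫ y : s → ℝ, ∏ j : s, Real.exp (-(y j) ^ 2) ∂(γ.map s.restrict) := by
    rw [integral_map (by fun_prop) (Continuous.aestronglyMeasurable (by fun_prop))]
    refine integral_congr_ae (ae_of_all _ fun x => ?_)
    simp only [Finset.restrict, ← Real.exp_sum, Finset.sum_neg_distrib]
    rw [Finset.sum_coe_sort s (fun n => (x n) ^ 2)]
  rw [h1, hγ s, integral_fintype_prod_eq_prod (fun (_ : s) (y : ℝ) => Real.exp (-y ^ 2))]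
  simp_rw [integral_exp_neg_sq_gaussianReal]
  exact Finset.prod_coe_sort s (fun n => (√(1 + 2 * (v n : ℝ)))⁻¹)

lemma map_eval_of_isProjectiveLimit {v : ι → ℝ≥0} {γ : Measure (ι → ℝ)}
    (hγ : IsProjectiveLimit γ fun J : Finset ι => Measure.pi fun j : J => gaussianReal 0 (v j))
    (n : ι) : γ.map (fun x => x n) = gaussianReal 0 (v n) := by
  have h := (measurePreserving_eval (fun j : ({n} : Finset ι) => gaussianReal 0 (v j))
    ⟨n, by simp⟩).map_eq
  have hn : γ.map ({n} : Finset ι).restrict =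
      Measure.pi fun j : ({n} : Finset ι) => gaussianReal 0 (v j) := hγ {n}
  rw [← hn, Measure.map_map (by fun_prop) (by fun_prop)] at h
  exact h

lemma lintegral_sq_of_isProjectiveLimit {v : ι → ℝ≥0} {γ : Measure (ι → ℝ)}
    (hγ : IsProjectiveLimit γ fun J : Finset ι => Measure.pi fun j : J => gaussianReal 0 (v j))
    (n : ι) : ∫⁻ x, ENNReal.ofReal ((x n) ^ 2) ∂γ = v n := by
  have h : ∫⁻ x, ENNReal.ofReal ((x n) ^ 2) ∂γ =
      ∫⁻ y, ENNReal.ofReal (y ^ 2) ∂(γ.map fun x => x n) := by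
    rw [lintegral_map (by fun_prop) (by fun_prop)]
  have hint : Integrable (fun y : ℝ => y ^ 2) (gaussianReal 0 (v n)) :=
    (memLp_id_gaussianReal 2).integrable_sq
  have hvar : ∫ y, y ^ 2 ∂(gaussianReal 0 (v n)) = v n := by
    have := variance_id_gaussianReal (μ := 0) (v := v n)
    rwa [variance_eq_integral (by fun_prop), show (id : ℝ → ℝ) = fun x => x from rfl,
      integral_id_gaussianReal, show (∫ y : ℝ, (y - 0) ^ 2 ∂gaussianReal 0 (v n)) =
      ∫ y : ℝ, y ^ 2 ∂gaussianReal 0 (v n) by simp] at this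
  rw [h, map_eval_of_isProjectiveLimit hγ, ← ofReal_integral_eq_lintegral_ofReal hint
    (ae_of_all _ fun y => sq_nonneg y), hvar, ENNReal.ofReal_coe_nnreal]

lemma ae_summable_sq_of_isProjectiveLimit [Countable ι] {v : ι → ℝ≥0} (hv : Summable v)
    {γ : Measure (ι → ℝ)}
    (hγ : IsProjectiveLimit γ fun J : Finset ι => Measure.pi fun j : J => gaussianReal 0 (v j)) :
    ∀ᵐ x ∂γ, Summable fun n => (x n) ^ 2 := by
  have h : ∫⁻ x, ∑' n, ENNReal.ofReal ((x n) ^ 2) ∂γ ≠ ⊤ := by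
    rw [lintegral_tsum fun n => Measurable.aemeasurable (by fun_prop)]
    simp_rw [lintegral_sq_of_isProjectiveLimit hγ]
    exact ENNReal.tsum_coe_ne_top_iff_summable.2 hv
  filter_upwards [ae_lt_top (by fun_prop) h] with x hx
  simpa [ENNReal.toReal_ofReal (sq_nonneg _)] using ENNReal.summable_toReal hx.ne

lemma integral_exp_neg_tsum_sq_le [Countable ι] {v : ι → ℝ≥0} (hv : Summable v)
    {γ : Measure (ι → ℝ)}
    (hγ : IsProjectiveLimit γ fun J : Finset ι => Measure.pi fun j : J => gaussianReal 0 (v j))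
    (t : Finset ι) :
    ∫ x, Real.exp (-∑' n, (x n) ^ 2) ∂γ ≤ ∏ n ∈ t, (√(1 + 2 * (v n : ℝ)))⁻¹ := by
  have := hγ.isProbabilityMeasure
  rw [← integral_exp_neg_sum_sq_of_isProjectiveLimit hγ t]
  refine integral_mono_of_nonneg (ae_of_all _ fun x => (Real.exp_pos _).le) ?_ ?_
  · refine Integrable.of_bound (C := 1) (Measurable.aestronglyMeasurable (by fun_prop)) (ae_of_all _ fun x => ?_)
    rw [Real.norm_eq_abs, abs_of_pos (Real.exp_pos _), Real.exp_le_one_iff, neg_nonpos]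
    positivity
  · filter_upwards [ae_summable_sq_of_isProjectiveLimit hv hγ] with x hx
    exact Real.exp_le_exp.2 (neg_le_neg (hx.sum_le_tsum t fun n _ => sq_nonneg _))

lemma integral_exp_neg_tsum_sq_of_finite_support [Countable ι] {v : ι → ℝ≥0} {s : Finset ι}
    (hv : ∀ n ∉ s, v n = 0) {γ : Measure (ι → ℝ)}
    (hγ : IsProjectiveLimit γ fun J : Finset ι => Measure.pi fun j : J => gaussianReal 0 (v j)) :
    ∫ x, Real.exp (-∑' n, (x n) ^ 2) ∂γ = ∏ n ∈ s, (√(1 + 2 * (v n : ℝ)))⁻¹ := by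
  rw [← integral_exp_neg_sum_sq_of_isProjectiveLimit hγ s]
  have h : ∀ᵐ x ∂γ, ∀ n ∉ s, x n = 0 := by
    rw [ae_all_iff]
    intro n
    by_cases hn : n ∈ s
    · simp [hn]
    have h0 := lintegral_sq_of_isProjectiveLimit hγ n
    rw [hv n hn, ENNReal.coe_zero, lintegral_eq_zero_iff (by fun_prop)] at h0
    filter_upwards [h0] with x hx _
    simpa [sq_nonpos_iff] using hx
  refine integral_congr_ae ?_
  filter_upwards [h] with x hx
  rw [tsum_eq_sum (s := s) fun n hn => by simp [hx n hn]]

lemma one_add_two_mul_sum_le_prod (f : ι → ℝ≥0) (s : Finset ι) :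
    1 + 2 * ∑ n ∈ s, (f n : ℝ) ≤ ∏ n ∈ s, (1 + 2 * (f n : ℝ)) := by
  classical
  induction s using Finset.induction_on with
  | empty => simp
  | insert a s ha ih =>
    rw [Finset.sum_insert ha, Finset.prod_insert ha]
    have h1 : 0 ≤ ∑ n ∈ s, (f n : ℝ) := by positivity
    have h2 : (0 : ℝ) ≤ f a := by positivity
    nlinarith [mul_nonneg h1 h2, mul_le_mul_of_nonneg_left ih h2]

lemma prod_inv_sqrt_eq (f : ι → ℝ≥0) (s : Finset ι) :
    ∏ n ∈ s, (√(1 + 2 * (f n : ℝ)))⁻¹ = (√(∏ n ∈ s, (1 + 2 * (f n : ℝ))))⁻¹ := by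
  rw [Finset.prod_inv_distrib, Real.sqrt_prod _ fun n _ => by positivity]

lemma exp_neg_sum_le_prod_inv_sqrt (f : ι → ℝ≥0) (s : Finset ι) :
    Real.exp (-∑ n ∈ s, (f n : ℝ)) ≤ ∏ n ∈ s, (√(1 + 2 * (f n : ℝ)))⁻¹ := by
  rw [← Finset.sum_neg_distrib, Real.exp_sum]
  refine Finset.prod_le_prod (fun n _ => (Real.exp_pos _).le) fun n _ => ?_
  rw [Real.exp_neg]
  refine inv_anti₀ (by positivity) (Real.sqrt_le_iff.2 ⟨(Real.exp_pos _).le, ?_⟩)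
  rw [← Real.exp_nat_mul]
  have := Real.add_one_le_exp (2 * (f n : ℝ))
  push_cast
  linarith

lemma mul_exp_neg_le_one_sub_inv_sqrt {b : ℝ} (hb : 0 ≤ b) :
    b * Real.exp (-(2 * b)) ≤ 1 - (√(1 + 2 * b))⁻¹ := by
  set q := √(1 + 2 * b) with hq
  have hq1 : 1 ≤ q := Real.one_le_sqrt.2 (by linarith)
  have hq2 : q ^ 2 = 1 + 2 * b := Real.sq_sqrt (by linarith)
  have h1 : Real.exp (-(2 * b)) ≤ (q ^ 2)⁻¹ := by
    rw [Real.exp_neg, hq2]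
    exact inv_anti₀ (by positivity) (by linarith [Real.add_one_le_exp (2 * b)])
  refine (mul_le_mul_of_nonneg_left h1 hb).trans ?_
  have hq0 : 0 < q := by linarith
  rw [← sub_nonneg, show 1 - q⁻¹ - b * (q ^ 2)⁻¹ = (q ^ 2 - q - b) / q ^ 2 by field_simp]
  refine div_nonneg ?_ (by positivity)
  nlinarith

lemma sum_sdiff_mul_exp_le_prod_sub_prod [DecidableEq ι] (f : ι → ℝ≥0) {s t : Finset ι}
    (hst : s ⊆ t) :
    (∑ n ∈ t \ s, (f n : ℝ)) * Real.exp (-(2 * ∑ n ∈ t, (f n : ℝ))) ≤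
      ∏ n ∈ s, (√(1 + 2 * (f n : ℝ)))⁻¹ - ∏ n ∈ t, (√(1 + 2 * (f n : ℝ)))⁻¹ := by
  rw [← Finset.prod_sdiff hst, ← Finset.sum_sdiff hst]
  set a := ∑ n ∈ s, (f n : ℝ)
  set b := ∑ n ∈ t \ s, (f n : ℝ) with hb
  have ha0 : 0 ≤ a := by positivity
  have hb0 : 0 ≤ b := by positivity
  have hA := exp_neg_sum_le_prod_inv_sqrt f s
  have hB : ∏ n ∈ t \ s, (√(1 + 2 * (f n : ℝ)))⁻¹ ≤ (√(1 + 2 * b))⁻¹ := by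
    rw [prod_inv_sqrt_eq]
    exact inv_anti₀ (by positivity) (Real.sqrt_le_sqrt (one_add_two_mul_sum_le_prod f _))
  calc b * Real.exp (-(2 * (b + a)))
      ≤ b * Real.exp (-(2 * b) + -a) := by gcongr; linarith
    _ = Real.exp (-a) * (b * Real.exp (-(2 * b))) := by rw [Real.exp_add]; ring
    _ ≤ (∏ n ∈ s, (√(1 + 2 * (f n : ℝ)))⁻¹) * (1 - (√(1 + 2 * b))⁻¹) := by
      gcongr
      exact mul_exp_neg_le_one_sub_inv_sqrt hb0
    _ ≤ (∏ n ∈ s, (√(1 + 2 * (f n : ℝ)))⁻¹) *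
        (1 - ∏ n ∈ t \ s, (√(1 + 2 * (f n : ℝ)))⁻¹) := by gcongr
    _ = _ := by ring

/-- Truncating the variances of a countable product of centered Gaussian measures to a finite set
`s` increases the expectation of `exp (-‖x‖²)` at least by an explicit amount. -/
lemma sum_sdiff_mul_exp_le_integral_sub_integral [Countable ι] [DecidableEq ι] {v w : ι → ℝ≥0}
    (hv : Summable v) {s t : Finset ι} (hst : s ⊆ t) (hws : ∀ n ∈ s, w n = v n)
    (hw : ∀ n ∉ s, w n = 0) {γs γ : Measure (ι → ℝ)}
    (hγs : IsProjectiveLimit γs fun J : Finset ι => Measure.pi fun j : J => gaussianReal 0 (w j))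
    (hγ : IsProjectiveLimit γ fun J : Finset ι => Measure.pi fun j : J => gaussianReal 0 (v j)) :
    (∑ n ∈ t \ s, (v n : ℝ)) * Real.exp (-(2 * ∑ n ∈ t, (v n : ℝ))) ≤
      (∫ x, Real.exp (-∑' n, (x n) ^ 2) ∂γs) - ∫ x, Real.exp (-∑' n, (x n) ^ 2) ∂γ := by
  rw [integral_exp_neg_tsum_sq_of_finite_support hw hγs,
    Finset.prod_congr rfl fun n hn => by rw [hws n hn]]
  exact (sum_sdiff_mul_exp_le_prod_sub_prod v hst).trans
    (sub_le_sub_left (integral_exp_neg_tsum_sq_le hv hγ t) _)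

end GaussianProduct

section PowerSums

lemma rpow_neg_sub_rpow_neg_le {r x y : ℝ} (hr : 0 < r) (hx : 0 < x) (hy : 0 < y) :
    x ^ (-r) - y ^ (-r) ≤ r * x ^ (-(r + 1)) * (y - x) := by
  have ht : 0 < y / x := div_pos hy hx
  have h1 : 1 - r * (y / x - 1) ≤ (y / x) ^ (-r) := by
    rw [Real.rpow_def_of_pos ht]
    have := Real.add_one_le_exp (Real.log (y / x) * -r)
    nlinarith [Real.log_le_sub_one_of_pos ht]
  rw [Real.div_rpow hy.le hx.le] at h1
  have hxr : 0 < x ^ (-r) := Real.rpow_pos_of_pos hx _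
  rw [le_div_iff₀ hxr] at h1
  have h2 : x ^ (-(r + 1)) = x ^ (-r) / x := by
    rw [show -(r + 1) = -r - 1 by ring, Real.rpow_sub_one hx.ne']
  have h3 : r * (x ^ (-r) / x) * (y - x) = r * (y / x - 1) * x ^ (-r) := by field_simp
  rw [h2, h3]
  linarith

lemma le_sum_Ioc_rpow_neg {r : ℝ} (hr : 0 < r) {N K : ℕ} (hNK : N ≤ K) :
    (((N : ℝ) + 1) ^ (-r) - ((K : ℝ) + 1) ^ (-r)) / r ≤
      ∑ n ∈ Finset.Ioc N K, (n : ℝ) ^ (-(r + 1)) := by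
  rw [div_le_iff₀ hr]
  induction K, hNK using Nat.le_induction with
  | base => simp
  | succ K hK ih =>
    rw [← Finset.insert_Ioc_right_eq_Ioc_add_one (by omega), Finset.sum_insert (by simp)]
    have := rpow_neg_sub_rpow_neg_le hr (x := (K : ℝ) + 1) (y := (K : ℝ) + 1 + 1)
      (by positivity) (by positivity)
    push_cast
    linarith

lemma sum_Icc_rpow_neg_le {r : ℝ} (hr : 0 < r) (K : ℕ) :
    ∑ n ∈ Finset.Icc 1 K, (n : ℝ) ^ (-(r + 1)) ≤ (r + 1) / r := by
  have key (K : ℕ) : r * ∑ n ∈ Finset.Icc 1 (K + 1), (n : ℝ) ^ (-(r + 1)) ≤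
      r + 1 - ((K : ℝ) + 1) ^ (-r) := by
    induction K with
    | zero => simp
    | succ K ih =>
      rw [Finset.sum_Icc_succ_top (by omega)]
      have := rpow_neg_sub_rpow_neg_le hr (x := (K : ℝ) + 1 + 1) (y := (K : ℝ) + 1)
        (by positivity) (by positivity)
      push_cast at ih ⊢
      linarith
  rw [le_div_iff₀' hr]
  cases K with
  | zero => simp; positivity
  | succ K => exact (key K).trans (sub_le_self _ (by positivity))

end PowerSums

section SinDiv

variable {e a : ℝ}

lemma abs_sin_div_le_one (he : e = 1 ∨ e = -1) (x : ℝ) : |Real.sin x / (e * x)| ≤ 1 := by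
  have he' : |e| = 1 := by rcases he with rfl | rfl <;> simp
  rw [abs_div, abs_mul, he', one_mul]
  exact div_le_one_of_le₀ Real.abs_sin_le_abs (abs_nonneg _)

lemma bddBelow_sin_div (he : e = 1 ∨ e = -1) :
    BddBelow (Set.range fun x : Set.Ici a => Real.sin x / (e * (x : ℝ))) :=
  ⟨-1, by rintro _ ⟨x, rfl⟩; exact (abs_le.1 (abs_sin_div_le_one he x)).1⟩

lemma neg_one_lt_sin_div (he : e = 1 ∨ e = -1) {x : ℝ} (hx : 0 < x) :
    -1 < Real.sin x / (e * x) := by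
  have h1 := Real.sin_lt hx
  have h2 := (abs_lt.1 (Real.abs_sin_lt_abs hx.ne')).1
  rw [abs_of_pos hx] at h2
  rcases he with rfl | rfl
  · rw [lt_div_iff₀ (by linarith)]; linarith
  · rw [neg_one_mul, div_neg, neg_lt_neg_iff, div_lt_one hx]; exact h1

lemma neg_one_lt_iInf_sin_div (he : e = 1 ∨ e = -1) (ha : 0 < a) :
    -1 < ⨅ x : Set.Ici a, Real.sin x / (e * (x : ℝ)) := by
  have he' : e ≠ 0 := by rcases he with rfl | rfl <;> simp
  obtain ⟨m, hm, hmin⟩ := (isCompact_Icc (a := a) (b := max a 2)).exists_isMinOn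
    (Set.nonempty_Icc.2 (le_max_left _ _)) (f := fun x => Real.sin x / (e * x))
    (ContinuousOn.div (by fun_prop) (by fun_prop) fun x hx =>
      mul_ne_zero he' (ha.trans_le hx.1).ne')
  have hlt : -1 < min (Real.sin m / (e * m)) (-(1 / 2)) :=
    lt_min (neg_one_lt_sin_div he (ha.trans_le hm.1)) (by norm_num)
  have : Nonempty (Set.Ici a) := ⟨⟨a, Set.self_mem_Ici⟩⟩
  refine hlt.trans_le (le_ciInf fun ⟨x, hx⟩ => ?_)
  by_cases hx2 : x ≤ max a 2
  · exact (min_le_left _ _).trans (hmin ⟨hx, hx2⟩)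
  · refine (min_le_right _ _).trans (abs_le.1 ?_).1
    have hx2' : 2 < x := (le_max_right _ _).trans_lt (not_le.1 hx2)
    have he1 : |e| = 1 := by rcases he with rfl | rfl <;> simp
    rw [abs_div, abs_mul, he1, one_mul, abs_of_pos (by linarith : 0 < x),
      div_le_div_iff₀ (by linarith) (by norm_num)]
    linarith [Real.abs_sin_le_one x]

end SinDiv

/-- Corollary 2.11 (Gaussian reformulation), the specialization of Corollary 2.10 to the
Dirichlet Laplacian on `(0,1)`: for `T ∈ (0,∞)`, `δ < 1/4`, `i ∈ {1,2}`, `λ_n = π² n²`,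
`σ_n² = λ_n^{2δ-1} (1/2)(T + sin(2√λ_n T)/((-1)^i 2√λ_n))` for `n ≥ 1`, and the countable
product probability measures `γ^N = ⨂_{n≥1} N(0, 𝟙_{{1,…,N}}(n) σ_n²)` and
`γ = ⨂_{n≥1} N(0, σ_n²)` on `ℝ^ℕ` (characterized as projective limits of the finite product
Gaussian measures), it holds for every `N ≥ 1` that
`∫ exp(-∑_{n≥1} x_n²) dγ^N - ∫ exp(-∑_{n≥1} x_n²) dγ
  ≥ (1 + inf_{x ∈ [2πT,∞)} sin x/((-1)^i x)) T (4π²)^{2δ-1} N^{4δ-1}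
      / ((1-4δ) exp(12(2δ-1)Tπ^{4δ-2}/(4δ-1))) > 0`. -/
theorem stmt_15 (T δ : ℝ) (hT : 0 < T) (hδ : δ < 1 / 4) (i : ℕ) (hi : i = 1 ∨ i = 2)
    (v : {n : ℕ // 1 ≤ n} → ℝ≥0)
    (hv : ∀ n : {n : ℕ // 1 ≤ n}, (v n : ℝ) =
      (π ^ 2 * ((n : ℕ) : ℝ) ^ 2) ^ (2 * δ - 1) * (1 / 2) *
        (T + Real.sin (2 * Real.sqrt (π ^ 2 * ((n : ℕ) : ℝ) ^ 2) * T) /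
          ((-1 : ℝ) ^ i * 2 * Real.sqrt (π ^ 2 * ((n : ℕ) : ℝ) ^ 2))))
    (N : ℕ) (hN : 1 ≤ N) (γN γ : Measure ({n : ℕ // 1 ≤ n} → ℝ))
    (hγN : IsProjectiveLimit γN fun J : Finset {n : ℕ // 1 ≤ n} =>
      Measure.pi fun j : J => gaussianReal 0 (if ((j : {n : ℕ // 1 ≤ n}) : ℕ) ≤ N then
        v (j : {n : ℕ // 1 ≤ n}) else 0))
    (hγ : IsProjectiveLimit γ fun J : Finset {n : ℕ // 1 ≤ n} =>
      Measure.pi fun j : J => gaussianReal 0 (v (j : {n : ℕ // 1 ≤ n}))) :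
    (∫ x, Real.exp (-∑' n, (x n) ^ 2) ∂γN) - ∫ x, Real.exp (-∑' n, (x n) ^ 2) ∂γ ≥
      (1 + ⨅ x : (Set.Ici (2 * π * T)), Real.sin x / ((-1 : ℝ) ^ i * (x : ℝ))) *
        T * (4 * π ^ 2) ^ (2 * δ - 1) * (N : ℝ) ^ (4 * δ - 1) /
        ((1 - 4 * δ) * Real.exp (12 * (2 * δ - 1) * T * π ^ (4 * δ - 2) / (4 * δ - 1))) ∧
    0 < (1 + ⨅ x : (Set.Ici (2 * π * T)), Real.sin x / ((-1 : ℝ) ^ i * (x : ℝ))) *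
        T * (4 * π ^ 2) ^ (2 * δ - 1) * (N : ℝ) ^ (4 * δ - 1) /
        ((1 - 4 * δ) * Real.exp (12 * (2 * δ - 1) * T * π ^ (4 * δ - 2) / (4 * δ - 1))) := by
  have he : (-1 : ℝ) ^ i = 1 ∨ (-1 : ℝ) ^ i = -1 := by
    rcases hi with rfl | rfl <;> simp
  generalize (-1 : ℝ) ^ i = e at *
  have hI := neg_one_lt_iInf_sin_div he (a := 2 * π * T) (by positivity)
  have hbdd := bddBelow_sin_div he (a := 2 * π * T)
  have hinf : ∀ x : Set.Ici (2 * π * T),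
      (⨅ x : Set.Ici (2 * π * T), Real.sin x / (e * (x : ℝ))) ≤ Real.sin x / (e * (x : ℝ)) :=
    ciInf_le hbdd
  generalize (⨅ x : Set.Ici (2 * π * T), Real.sin x / (e * (x : ℝ))) = I at *
  obtain ⟨r, rfl⟩ : ∃ r, δ = (1 - r) / 4 := ⟨1 - 4 * δ, by ring⟩
  have hr : 0 < r := by linarith
  have hN0 : (0 : ℝ) < N := by exact_mod_cast hN
  have hI1 : 0 < 1 + I := by linarith
  have e1 : 2 * ((1 - r) / 4) - 1 = -(r + 1) / 2 := by ring
  have e2 : 4 * ((1 - r) / 4) - 1 = -r := by ring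
  have e3 : 4 * ((1 - r) / 4) - 2 = -(r + 1) := by ring
  have e4 : 1 - 4 * ((1 - r) / 4) = r := by ring
  simp only [e1, e2, e3, e4] at hv ⊢
  refine ⟨?_, by positivity⟩
  set p := π ^ (-(r + 1)) with hp
  have hp0 : 0 < p := by positivity
  have hv' : ∀ n : {n : ℕ // 1 ≤ n}, ∃ q, I ≤ q ∧ q ≤ 1 ∧
      (v n : ℝ) = p * (T / 2) * (1 + q) * ((n : ℕ) : ℝ) ^ (-(r + 1)) := by
    intro n
    have hn : (1 : ℝ) ≤ (n : ℕ) := by exact_mod_cast n.2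
    have hn0 : (0 : ℝ) < (n : ℕ) := by linarith
    have he0 : e ≠ 0 := by rcases he with rfl | rfl <;> simp
    refine ⟨Real.sin (2 * (π * (n : ℕ)) * T) / (e * (2 * (π * (n : ℕ)) * T)),
      hinf ⟨2 * (π * (n : ℕ)) * T, ?_⟩, (abs_le.1 (abs_sin_div_le_one he _)).2, ?_⟩
    · rw [Set.mem_Ici]
      have : 0 < 2 * π * T := by positivity
      nlinarith
    · rw [hv n, ← mul_pow, Real.sqrt_sq (by positivity), ← Real.rpow_natCast,
        ← Real.rpow_mul (by positivity), Real.mul_rpow (by positivity) (by positivity)]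
      rw [show ((2 : ℕ) : ℝ) * (-(r + 1) / 2) = -(r + 1) by push_cast; ring, ← hp]
      field_simp
  have hvle (n : {n : ℕ // 1 ≤ n}) : (v n : ℝ) ≤ p * T * ((n : ℕ) : ℝ) ^ (-(r + 1)) := by
    obtain ⟨q, -, hq, h⟩ := hv' n
    rw [h]
    refine mul_le_mul_of_nonneg_right ?_ (by positivity)
    nlinarith [mul_pos hp0 hT]
  have hlev (n : {n : ℕ // 1 ≤ n}) :
      p * (T / 2) * (1 + I) * ((n : ℕ) : ℝ) ^ (-(r + 1)) ≤ (v n : ℝ) := by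
    obtain ⟨q, hq, -, h⟩ := hv' n
    rw [h]
    gcongr
  have hsum : Summable v := by
    rw [← NNReal.summable_coe]
    refine Summable.of_nonneg_of_le (fun n => (v n).2) hvle (Summable.mul_left _ ?_)
    exact (Real.summable_nat_rpow.2 (by linarith)).comp_injective Subtype.val_injective
  let J (K : ℕ) : Finset {n : ℕ // 1 ≤ n} := (Finset.Icc 1 K).subtype (1 ≤ ·)
  have hJ (K : ℕ) (n : {n : ℕ // 1 ≤ n}) : n ∈ J K ↔ (n : ℕ) ≤ K := by
    simp [J, n.2]
  have hJsum (K : ℕ) : ∑ n ∈ J K, (v n : ℝ) ≤ p * T * ((r + 1) / r) := by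
    refine (Finset.sum_le_sum fun n _ => hvle n).trans ?_
    rw [← Finset.mul_sum, Finset.sum_subtype_of_mem (fun n : ℕ => (n : ℝ) ^ (-(r + 1)))
      fun n hn => (Finset.mem_Icc.1 hn).1]
    gcongr
    exact sum_Icc_rpow_neg_le hr K
  have hJsdiff (K : ℕ) (hK : N ≤ K) :
      p * (T / 2) * (1 + I) * ((((N : ℝ) + 1) ^ (-r) - ((K : ℝ) + 1) ^ (-r)) / r) ≤
        ∑ n ∈ J K \ J N, (v n : ℝ) := by
    refine le_trans ?_ (Finset.sum_le_sum fun n _ => hlev n)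
    have h : J K \ J N = (Finset.Ioc N K).subtype (1 ≤ ·) := by
      ext n
      simp only [Finset.mem_sdiff, hJ, Finset.mem_subtype, Finset.mem_Ioc]
      omega
    rw [h, ← Finset.mul_sum, Finset.sum_subtype_of_mem (fun n : ℕ => (n : ℝ) ^ (-(r + 1)))
      fun n hn => hN.trans (Finset.mem_Ioc.1 hn).1.le]
    gcongr
    exact le_sum_Ioc_rpow_neg hr hK
  set E := 12 * (-(r + 1) / 2) * T * p / -r with hE
  have hE' : E = 6 * (p * T * ((r + 1) / r)) := by rw [hE]; field_simp; ring
  have hM0 : 0 < p * T * ((r + 1) / r) := by positivity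
  have hmain (K : ℕ) (hK : N ≤ K) :
      p * (T / 2) * (1 + I) * ((((N : ℝ) + 1) ^ (-r) - ((K : ℝ) + 1) ^ (-r)) / r) *
        Real.exp (-E) ≤
      (∫ x, Real.exp (-∑' n, (x n) ^ 2) ∂γN) - ∫ x, Real.exp (-∑' n, (x n) ^ 2) ∂γ := by
    refine le_trans ?_ (sum_sdiff_mul_exp_le_integral_sub_integral (s := J N) (t := J K)
      (w := fun n : {n : ℕ // 1 ≤ n} => if (n : ℕ) ≤ N then v n else 0) hsum ?_ ?_ ?_ hγN hγ)
    · gcongr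
      · exact hJsdiff K hK
      · linarith [hJsum K]
    · intro n hn
      rw [hJ] at hn ⊢
      omega
    · intro n hn
      rw [hJ] at hn
      simp [hn]
    · intro n hn
      rw [hJ] at hn
      simp [hn]
  have hlim : Filter.Tendsto (fun K : ℕ =>
      p * (T / 2) * (1 + I) * ((((N : ℝ) + 1) ^ (-r) - ((K : ℝ) + 1) ^ (-r)) / r) *
        Real.exp (-E)) Filter.atTop
      (nhds (p * (T / 2) * (1 + I) * ((((N : ℝ) + 1) ^ (-r) - 0) / r) * Real.exp (-E))) := by
    have h : Filter.Tendsto (fun K : ℕ => ((K : ℝ) + 1) ^ (-r)) Filter.atTop (nhds 0) :=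
      (tendsto_rpow_neg_atTop hr).comp
        (Filter.tendsto_atTop_add_const_right _ _ tendsto_natCast_atTop_atTop)
    exact (((h.const_sub _).div_const r).const_mul _).mul_const _
  have hfin := le_of_tendsto hlim ((Filter.eventually_ge_atTop N).mono hmain)
  refine le_trans ?_ hfin
  have hpow : (2 * (N : ℝ)) ^ (-r) ≤ ((N : ℝ) + 1) ^ (-r) := by
    have : (1 : ℝ) ≤ N := by exact_mod_cast hN
    exact Real.rpow_le_rpow_of_nonpos (by positivity) (by linarith) (by linarith)
  have h4 : (4 * π ^ 2) ^ (-(r + 1) / 2) = 2 ^ (-r) / 2 * p := by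
    rw [show 4 * π ^ 2 = (2 * π) ^ (2 : ℝ) by rw [Real.rpow_two]; ring,
      ← Real.rpow_mul (by positivity), show 2 * (-(r + 1) / 2) = -(r + 1) by ring,
      Real.mul_rpow (by positivity) (by positivity), ← hp,
      show -(r + 1) = -r - 1 by ring, Real.rpow_sub_one (by norm_num)]
  rw [Real.mul_rpow (by positivity) hN0.le] at hpow
  calc (1 + I) * T * (4 * π ^ 2) ^ (-(r + 1) / 2) * (N : ℝ) ^ (-r) / (r * Real.exp E)
      = p * (T / 2) * (1 + I) * ((2 ^ (-r) * (N : ℝ) ^ (-r)) / r) * Real.exp (-E) := by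
        rw [h4, Real.exp_neg]
        field_simp
    _ ≤ p * (T / 2) * (1 + I) * ((((N : ℝ) + 1) ^ (-r) - 0) / r) * Real.exp (-E) := by
        rw [sub_zero]
        gcongr
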